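/- For a finite-dimensional vector superspace V with even dimension d₀ and odd dimension d₁, the dimension of the n-th alternating superpower ⋀ⁿV equals Σ_{k=0}^{min(d₀,n)} C(d₀, k) · C(d₁ + (n-k) - 1, n-k). -/

import Mathlib

open scoped TensorProduct
open PiTensorProduct

namespace SuperPow

/-- parity of a basis index -/
def par {α β : Type} : α ⊕ β → ZMod 2
  | Sum.inl _ => 0
  | Sum.inr _ => 1

/-- the super sign of a pair of basis indices -/
def csgn (F : Type) [Field F] {α β : Type} [LinearOrder α] : α ⊕ β → α ⊕ β → F
  | Sum.inl a, Sum.inl b => if a < b then 1 else if b < a then -1 else 0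
  | Sum.inl _, Sum.inr _ => 1
  | Sum.inr _, Sum.inl _ => -1
  | Sum.inr _, Sum.inr _ => 1

theorem csgn_swap (F : Type) [Field F] {α β : Type} [LinearOrder α] (x y : α ⊕ β) :
    csgn F x y = -(-1) ^ (par x * par y).val * csgn F y x := by
  have h : ZMod.val (1 : ZMod 2) = 1 := rfl
  rcases x with a | a <;> rcases y with b | b <;> simp [csgn, par, h]
  rcases lt_trichotomy a b with h | h | h
  · simp [h, h.not_gt]
  · simp [h]
  · simp [h, h.not_gt]

theorem csgn_eq_zero (F : Type) [Field F] {α β : Type} [LinearOrder α] (x y : α ⊕ β) :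
    csgn F x y = 0 ↔ x = y ∧ par x = 0 := by
  rcases x with a | a <;> rcases y with b | b <;> simp [csgn, par]
  rcases lt_trichotomy a b with h | h | h
  · simp [h, h.ne]
  · simp [h]
  · simp [h, h.not_gt, h.ne']

/-- the super sign of a word -/
def sgn (F : Type) [Field F] {α β : Type} [LinearOrder α] {n : ℕ} (f : Fin n → α ⊕ β) : F :=
  ∏ p ∈ (Finset.univ : Finset (Fin n × Fin n)).filter (fun p => p.1 < p.2),
    csgn F (f p.1) (f p.2)

theorem sgn_eq_zero (F : Type) [Field F] {α β : Type} [LinearOrder α] {n : ℕ}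
    (f : Fin n → α ⊕ β) : sgn F f = 0 ↔ ∃ i j, i < j ∧ f i = f j ∧ par (f i) = 0 := by
  simp [sgn, Finset.prod_eq_zero_iff, csgn_eq_zero]

theorem sgn_swap (F : Type) [Field F] {α β : Type} [LinearOrder α] {N : ℕ}
    (f : Fin (N + 1) → α ⊕ β) (i : Fin N) :
    sgn F (f ∘ Equiv.swap i.castSucc i.succ) =
      -(-1) ^ (par (f i.castSucc) * par (f i.succ)).val * sgn F f := by
  classical
  set S := (Finset.univ : Finset (Fin (N+1) × Fin (N+1))).filter
    (fun p => p.1 < p.2 ∧ p ≠ (i.castSucc, i.succ)) with hS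
  have hins : (Finset.univ : Finset (Fin (N+1) × Fin (N+1))).filter (fun p => p.1 < p.2)
      = insert (i.castSucc, i.succ) S := by
    ext ⟨a, b⟩
    simp only [hS, Finset.mem_filter, Finset.mem_univ, true_and, Finset.mem_insert]
    constructor
    · intro h
      by_cases h' : (a, b) = (i.castSucc, i.succ)
      · exact Or.inl h'
      · exact Or.inr ⟨h, h'⟩
    · rintro (h | h)
      · simp only [Prod.mk.injEq] at h
        rw [h.1, h.2]
        exact Fin.castSucc_lt_succ
      · exact h.1
  have hnot : (i.castSucc, i.succ) ∉ S := by simp [hS]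
  unfold sgn
  rw [hins, Finset.prod_insert hnot, Finset.prod_insert hnot]
  have key : ∏ p ∈ S, csgn F ((f ∘ Equiv.swap i.castSucc i.succ) p.1)
      ((f ∘ Equiv.swap i.castSucc i.succ) p.2) = ∏ p ∈ S, csgn F (f p.1) (f p.2) := by
    refine Finset.prod_equiv
      ((Equiv.swap i.castSucc i.succ).prodCongr (Equiv.swap i.castSucc i.succ)) ?_ ?_
    · rintro ⟨a, b⟩
      simp only [hS, Finset.mem_filter, Finset.mem_univ, true_and, Equiv.prodCongr_apply,
        Prod.map_apply, ne_eq, Prod.mk.injEq, Equiv.swap_apply_def, Fin.ext_iff, Fin.lt_def]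
      split_ifs <;> simp_all <;> omega
    · rintro ⟨a, b⟩ _
      rfl
  rw [key]
  simp only [Function.comp_apply, Equiv.swap_apply_left, Equiv.swap_apply_right]
  rw [csgn_swap F (f i.succ), mul_comm (par (f i.succ)), mul_assoc]

/-- the multiset of letters -/
def letters {γ : Type} {n : ℕ} (f : Fin n → γ) : Multiset γ := (Finset.univ.val).map f

theorem letters_comp {γ : Type} {n : ℕ} (f : Fin n → γ) (σ : Equiv.Perm (Fin n)) :
    letters (f ∘ σ) = letters f := by
  unfold letters
  rw [← Multiset.map_map, Multiset.map_univ_val_equiv]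

theorem exists_perm {γ : Type} {n : ℕ} (f g : Fin n → γ) (h : letters f = letters g) :
    ∃ σ : Equiv.Perm (Fin n), f = g ∘ σ := by
  classical
  have hc : ∀ c, Fintype.card {i // f i = c} = Fintype.card {i // g i = c} := by
    intro c
    have := congrArg (Multiset.count c) h
    simp only [letters, Multiset.count_map] at this
    rw [Fintype.card_subtype, Fintype.card_subtype]
    simp only [Finset.card, Finset.filter_val]
    simpa only [eq_comm] using this
  refine ⟨Equiv.ofFiberEquiv fun c => Fintype.equivOfCardEq (hc c), ?_⟩
  funext i
  exact (Equiv.ofFiberEquiv_map _ i).symm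

theorem exists_letters {γ : Type} {n : ℕ} (m : Multiset γ) (h : m.card = n) :
    ∃ f : Fin n → γ, letters f = m := by
  subst h
  induction m using Quotient.inductionOn with
  | h l =>
    refine ⟨l.get, ?_⟩
    change Multiset.map l.get (List.finRange l.length : Multiset (Fin l.length)) = (l : Multiset γ)
    rw [Multiset.map_coe]
    exact congrArg _ (by apply List.ext_get <;> simp)

/-- index type for the basis of the super exterior power -/
abbrev Idx (α β : Type) (n : ℕ) : Type :=
  Σ k : Fin (n + 1), {s : Finset α // s.card = (k : ℕ)} × Sym β (n - k)

/-- The multiset of an index -/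
def toM {α β : Type} {n : ℕ} (x : Idx α β n) : Multiset (α ⊕ β) :=
  x.2.1.1.val.map Sum.inl + (x.2.2 : Multiset β).map Sum.inr

theorem toM_card {α β : Type} {n : ℕ} (x : Idx α β n) : (toM x).card = n := by
  obtain ⟨k, ⟨s, hs⟩, t⟩ := x
  have := k.2
  simp only [toM, Multiset.card_add, Multiset.card_map, Finset.card_val, hs, Sym.card_coe]
  omega

theorem fm_inl {α β : Type} (s : Multiset α) (t : Multiset β) :
    (s.map Sum.inl + t.map Sum.inr : Multiset (α ⊕ β)).filterMap Sum.getLeft? = s := by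
  rw [Multiset.filterMap_add, Multiset.filterMap_map, Multiset.filterMap_map]
  have h1 : ((Sum.getLeft? : α ⊕ β → Option α) ∘ Sum.inl) = some := rfl
  have h2 : (Sum.getLeft? ∘ Sum.inr : β → Option α) = fun _ => none := rfl
  have h3 : Multiset.filterMap (fun _ : β => (none : Option α)) t = 0 := by
    induction t using Multiset.induction_on <;> simp_all
  rw [h1, h2, h3, Multiset.filterMap_some, add_zero]

theorem fm_inr {α β : Type} (s : Multiset α) (t : Multiset β) :
    (s.map Sum.inl + t.map Sum.inr : Multiset (α ⊕ β)).filterMap Sum.getRight? = t := by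
  rw [Multiset.filterMap_add, Multiset.filterMap_map, Multiset.filterMap_map]
  have h1 : ((Sum.getRight? : α ⊕ β → Option β) ∘ Sum.inr) = some := rfl
  have h2 : (Sum.getRight? ∘ Sum.inl : α → Option β) = fun _ => none := rfl
  have h3 : Multiset.filterMap (fun _ : α => (none : Option β)) s = 0 := by
    induction s using Multiset.induction_on <;> simp_all
  rw [h1, h2, h3, Multiset.filterMap_some, zero_add]

theorem split_m {α β : Type} (m : Multiset (α ⊕ β)) :
    (m.filterMap Sum.getLeft?).map Sum.inl + (m.filterMap Sum.getRight?).map Sum.inr = m := by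
  induction m using Multiset.induction_on with
  | empty => simp
  | cons a m ih =>
    rcases a with a | a
    · rw [Multiset.filterMap_cons_some Sum.getLeft? (Sum.inl a) _ (b := a) rfl,
        Multiset.filterMap_cons_none (f := Sum.getRight?) (Sum.inl a) _ rfl,
        Multiset.map_cons, Multiset.cons_add, ih]
    · rw [Multiset.filterMap_cons_some Sum.getRight? (Sum.inr a) _ (b := a) rfl,
        Multiset.filterMap_cons_none (f := Sum.getLeft?) (Sum.inr a) _ rfl,
        Multiset.map_cons, Multiset.add_cons, ih]

theorem toM_inj {α β : Type} {n : ℕ} : Function.Injective (toM : Idx α β n → _) := by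
  rintro ⟨k, ⟨s, hs⟩, t⟩ ⟨k', ⟨s', hs'⟩, t'⟩ h
  have h1 := congrArg (Multiset.filterMap Sum.getLeft?) h
  have h2 := congrArg (Multiset.filterMap Sum.getRight?) h
  simp only [toM, fm_inl, fm_inr] at h1 h2
  have h3 : s = s' := Finset.val_injective h1
  subst h3
  have h4 : k = k' := Fin.ext (hs.symm.trans hs')
  subst h4
  have h5 : t = t' := Sym.coe_injective h2
  subst h5
  rfl

theorem toM_surj {α β : Type} {n : ℕ} (m : Multiset (α ⊕ β)) (hc : m.card = n)
    (hn : (m.filterMap Sum.getLeft?).Nodup) : ∃ x : Idx α β n, toM x = m := by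
  have hs := split_m m
  have hcc := congrArg Multiset.card hs
  rw [Multiset.card_add, Multiset.card_map, Multiset.card_map, hc] at hcc
  refine ⟨⟨⟨(m.filterMap Sum.getLeft?).card, by omega⟩, ⟨⟨_, hn⟩, rfl⟩,
    ⟨m.filterMap Sum.getRight?, by simp only; omega⟩⟩, ?_⟩
  exact hs

theorem count_left {α β : Type} [DecidableEq α] [DecidableEq β] (m : Multiset (α ⊕ β)) (a : α) :
    (m.filterMap Sum.getLeft?).count a = m.count (Sum.inl a) := by
  conv_rhs => rw [← split_m m]
  rw [Multiset.count_add, Multiset.count_map_eq_count' _ _ Sum.inl_injective]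
  have : Multiset.count (Sum.inl a) ((m.filterMap Sum.getRight?).map Sum.inr) = 0 := by
    rw [Multiset.count_eq_zero]
    simp
  omega

theorem nodup_iff (F : Type) [Field F] {α β : Type} [LinearOrder α] {n : ℕ}
    (f : Fin n → α ⊕ β) :
    sgn F f ≠ 0 ↔ ((letters f).filterMap Sum.getLeft?).Nodup := by
  classical
  rw [Multiset.nodup_iff_count_le_one, ne_eq, sgn_eq_zero]
  simp only [count_left]
  constructor
  · intro h a
    by_contra hlt
    push Not at hlt
    rw [letters, Multiset.count_map] at hlt
    have hlt' : 1 < (Finset.univ.filter (fun i => Sum.inl a = f i)).card := hlt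
    obtain ⟨i, hi, j, hj, hij⟩ := Finset.one_lt_card.1 hlt'
    simp only [Finset.mem_filter, Finset.mem_univ, true_and] at hi hj
    rcases lt_or_gt_of_ne hij with hl | hl
    · exact h ⟨i, j, hl, by rw [← hi, ← hj], by rw [← hi]; rfl⟩
    · exact h ⟨j, i, hl, by rw [← hi, ← hj], by rw [← hj]; rfl⟩
  · rintro h ⟨i, j, hij, he, hp⟩
    rcases hfi : f i with a | b
    · have h' := h a
      rw [letters, Multiset.count_map] at h'
      have h'' : (Finset.univ.filter (fun i => Sum.inl a = f i)).card ≤ 1 := h'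
      have := Finset.card_le_one.1 h'' i (by simp [hfi]) j (by simp [← he, hfi])
      exact hij.ne this
    · rw [hfi] at hp
      simp [par] at hp

theorem card_Idx (d₀ d₁ n : ℕ) : Fintype.card (Idx (Fin d₀) (Fin d₁) n) =
    ∑ k ∈ Finset.range (min d₀ n + 1),
          Nat.choose d₀ k * Nat.choose (d₁ + (n - k) - 1) (n - k) := by
  rw [Fintype.card_sigma]
  simp only [Fintype.card_prod, Fintype.card_finset_len, Sym.card_sym_eq_choose, Fintype.card_fin]
  rw [Fin.sum_univ_eq_sum_range
    (fun k => Nat.choose d₀ k * Nat.choose (d₁ + (n - k) - 1) (n - k)) (n + 1)]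
  symm
  apply Finset.sum_subset
  · intro k
    simp only [Finset.mem_range]
    omega
  · intro k hk hk'
    simp only [Finset.mem_range] at hk hk'
    rw [Nat.choose_eq_zero_of_lt (by omega), zero_mul]

theorem core (F : Type) [Field F] (hchar : (2 : F) ≠ 0) {α β : Type} [LinearOrder α]
    [Fintype α] [Fintype β] (N : ℕ) (T : Type) [AddCommGroup T] [Module F T]
    (e : Module.Basis (Fin (N + 1) → α ⊕ β) F T) (R : Submodule F T)
    (h1 : ∀ (f : Fin (N + 1) → α ⊕ β) (i : Fin N),
      e f + (-1 : F) ^ (par (f i.castSucc) * par (f i.succ)).val •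
        e (f ∘ Equiv.swap i.castSucc i.succ) ∈ R)
    (h2 : ∀ Φ : T →ₗ[F] (Multiset (α ⊕ β) →₀ F),
      (∀ (f : Fin (N + 1) → α ⊕ β) (i : Fin N),
        Φ (e (f ∘ Equiv.swap i.castSucc i.succ)) =
          (-(-1 : F) ^ (par (f i.castSucc) * par (f i.succ)).val) • Φ (e f)) →
      R ≤ LinearMap.ker Φ) :
    Module.finrank F (T ⧸ R) = Nat.card (Idx α β (N + 1)) := by
  classical
  set q : (Fin (N + 1) → α ⊕ β) → T ⧸ R := fun f => R.mkQ (e f) with hq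
  have hsq : ∀ k : ℕ, ((-1 : F) ^ k) * (-1) ^ k = 1 := fun k => by
    rw [← mul_pow]; simp
  have hstep : ∀ (f : Fin (N + 1) → α ⊕ β) (i : Fin N),
      q (f ∘ Equiv.swap i.castSucc i.succ) =
        (-(-1 : F) ^ (par (f i.castSucc) * par (f i.succ)).val) • q f := by
    intro f i
    have := (Submodule.Quotient.mk_eq_zero R).2 (h1 f i)
    rw [Submodule.Quotient.mk_add, Submodule.Quotient.mk_smul] at this
    have h3 := congrArg (fun z => (-1 : F) ^ (par (f i.castSucc) * par (f i.succ)).val • z) this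
    simp only [smul_add, smul_smul, hsq, one_smul, smul_zero] at h3
    rw [neg_smul]
    exact (neg_eq_of_add_eq_zero_right h3).symm
  -- all permutations
  have hperm : ∀ (σ : Equiv.Perm (Fin (N + 1))) (f : Fin (N + 1) → α ⊕ β),
      ∃ ε : F, ε ≠ 0 ∧ q (f ∘ σ) = ε • q f ∧ sgn F (f ∘ σ) = ε * sgn F f := by
    intro σ
    have hσ : σ ∈ Submonoid.closure
        (Set.range fun i : Fin N ↦ Equiv.swap i.castSucc i.succ) := by
      rw [Equiv.Perm.mclosure_swap_castSucc_succ]; trivial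
    induction hσ using Submonoid.closure_induction with
    | mem x hx =>
      obtain ⟨i, rfl⟩ := hx
      intro f
      refine ⟨_, ?_, hstep f i, sgn_swap F f i⟩
      exact neg_ne_zero.2 (pow_ne_zero _ (neg_ne_zero.2 one_ne_zero))
    | one => exact fun f => ⟨1, one_ne_zero, by simp, by simp⟩
    | mul x y _ _ hx hy =>
      intro f
      obtain ⟨a, ha, ha1, ha2⟩ := hx f
      obtain ⟨b, hb, hb1, hb2⟩ := hy (f ∘ x)
      refine ⟨b * a, mul_ne_zero hb ha, ?_, ?_⟩
      · rw [Equiv.Perm.coe_mul, ← Function.comp_assoc, hb1, ha1, smul_smul]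
      · rw [Equiv.Perm.coe_mul, ← Function.comp_assoc, hb2, ha2, mul_assoc]
  -- vanishing
  have hzero : ∀ f : Fin (N + 1) → α ⊕ β, sgn F f = 0 → q f = 0 := by
    intro f hf
    obtain ⟨i, j, hij, he, hp⟩ := (sgn_eq_zero F f).1 hf
    have hN : 0 < N := by
      have := i.2; have := j.2; have : (i : ℕ) < j := hij
      omega
    let z : Fin N := ⟨0, hN⟩
    let τ := Equiv.swap z.castSucc i
    let σ : Equiv.Perm (Fin (N + 1)) := Equiv.swap (τ z.succ) j * τ
    have hτ : τ z.castSucc = i := Equiv.swap_apply_left _ _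
    have hσx : σ z.castSucc = i := by
      show Equiv.swap (τ z.succ) j (τ z.castSucc) = i
      rw [hτ]
      apply Equiv.swap_apply_of_ne_of_ne
      · rw [← hτ]
        intro h
        exact (Fin.castSucc_lt_succ (i := z)).ne (τ.injective h)
      · exact hij.ne
    have hσy : σ z.succ = j := Equiv.swap_apply_left _ _
    obtain ⟨ε, hε, hε1, -⟩ := hperm σ f
    have h3 := hstep (f ∘ σ) z
    have h4 : (f ∘ σ) ∘ Equiv.swap z.castSucc z.succ = f ∘ σ := by
      funext k
      simp only [Function.comp_apply, Equiv.swap_apply_def]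
      split_ifs with h h
      · rw [h, hσx, hσy, he]
      · rw [h, hσx, hσy, he]
      · rfl
    rw [h4] at h3
    simp only [Function.comp_apply, hσx, hp, zero_mul, ZMod.val_zero, pow_zero, neg_smul,
      one_smul] at h3
    have h5 : (2 : F) • q (f ∘ σ) = 0 := by
      rw [two_smul]; nth_rewrite 1 [h3]; simp
    have h6 : q (f ∘ σ) = 0 := (smul_eq_zero.1 h5).resolve_left hchar
    rw [hε1] at h6
    exact (smul_eq_zero.1 h6).resolve_left hε
  -- the functional
  let Φ : T →ₗ[F] (Multiset (α ⊕ β) →₀ F) :=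
    e.constr F (fun f => Finsupp.single (letters f) (sgn F f))
  have hΦ : ∀ f, Φ (e f) = Finsupp.single (letters f) (sgn F f) := fun f =>
    e.constr_basis F _ f
  have hker : R ≤ LinearMap.ker Φ := by
    apply h2
    intro f i
    rw [hΦ, hΦ, letters_comp, sgn_swap, Finsupp.smul_single, smul_eq_mul]
  let Ψ := R.liftQ Φ hker
  have hΨ : ∀ f, Ψ (q f) = Finsupp.single (letters f) (sgn F f) := fun f => hΦ f
  -- representatives
  choose rep hrep using fun x : Idx α β (N + 1) => exists_letters (toM x) (toM_card x)
  have hrs : ∀ x, sgn F (rep x) ≠ 0 := by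
    intro x
    rw [nodup_iff, hrep, toM, fm_inl]
    exact x.2.1.1.nodup
  have hli : LinearIndependent F (fun x => q (rep x)) := by
    apply LinearIndependent.of_comp Ψ
    have hs : LinearIndependent F
        (fun x : Idx α β (N + 1) => (Finsupp.single (toM x) (1 : F))) :=
      (Finsupp.linearIndependent_single_one F (Multiset (α ⊕ β))).comp _ toM_inj
    have := hs.units_smul (fun x => Units.mk0 _ (hrs x))
    have hfun : (Ψ ∘ fun x => q (rep x)) = ((fun x => Units.mk0 _ (hrs x)) •
        fun x : Idx α β (N + 1) => (Finsupp.single (toM x) (1 : F))) := by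
      funext x
      simp [hΨ, hrep, Units.smul_def]
    rw [hfun]
    exact this
  have hsp : ⊤ ≤ Submodule.span F (Set.range (fun x => q (rep x))) := by
    have htop : Submodule.map R.mkQ (Submodule.span F (Set.range e)) = ⊤ := by
      rw [e.span_eq, Submodule.map_top, Submodule.range_mkQ]
    rw [← htop, Submodule.map_span, Submodule.span_le]
    rintro _ ⟨_, ⟨f, rfl⟩, rfl⟩
    change q f ∈ _
    by_cases hf : sgn F f = 0
    · rw [hzero f hf]; exact Submodule.zero_mem _
    · obtain ⟨x, hx⟩ := toM_surj (n := N + 1) (letters f) (by simp [letters])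
        ((nodup_iff F f).1 hf)
      obtain ⟨σ, hσ⟩ := exists_perm f (rep x) (by rw [hrep, hx])
      obtain ⟨ε, -, hε, -⟩ := hperm σ (rep x)
      rw [hσ, hε]
      exact Submodule.smul_mem _ _ (Submodule.subset_span ⟨x, rfl⟩)
  exact Module.finrank_eq_nat_card_basis (Module.Basis.mk hli hsp)

theorem exists_basis (F : Type) [Field F]
    (V : Type) [AddCommGroup V] [Module F V] [FiniteDimensional F V]
    (gV : ZMod 2 → Submodule F V) (hgV : DirectSum.IsInternal gV) :
    ∃ b : Module.Basis (Fin (Module.finrank F (gV 0)) ⊕ Fin (Module.finrank F (gV 1))) F V,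
      (∀ x, b x ∈ gV (par x)) ∧
      ∀ p, ∀ v ∈ gV p, ∀ x, b.repr v x ≠ 0 → par x = p := by
  let B := hgV.collectedBasis (fun i => Module.finBasis F (gV i))
  let E : (Σ i : ZMod 2, Fin (Module.finrank F (gV i))) ≃
      Fin (Module.finrank F (gV 0)) ⊕ Fin (Module.finrank F (gV 1)) :=
    { toFun := fun x => match x with
        | ⟨(0 : Fin 2), a⟩ => Sum.inl a
        | ⟨(1 : Fin 2), a⟩ => Sum.inr a
      invFun := fun y => match y with
        | Sum.inl a => ⟨0, a⟩
        | Sum.inr a => ⟨1, a⟩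
      left_inv := by
        rintro ⟨i, a⟩
        match i, a with
        | (0 : Fin 2), a => rfl
        | (1 : Fin 2), a => rfl
      right_inv := by
        rintro (a | a) <;> rfl }
  have hE : ∀ y, (E.symm y).1 = par y := by
    rintro (a | a) <;> rfl
  refine ⟨B.reindex E, ?_, ?_⟩
  · intro x
    rw [Module.Basis.reindex_apply, ← hE]
    exact hgV.collectedBasis_mem _ _
  · intro p v hv x hx
    rw [Module.Basis.repr_reindex_apply] at hx
    by_contra hne
    apply hx
    rw [← hE] at hne
    exact hgV.collectedBasis_repr_of_mem_ne _ (Ne.symm hne) hv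

end SuperPow

/-- For a finite-dimensional vector superspace `V` with even dimension `d₀`
and odd dimension `d₁`, the `n`-th alternating superpower `⋀ⁿV := (⊗ⁿV)/R̂ₙ` (where `R̂ₙ`
is spanned by `⊗v + (-1)^{ε(vᵢ)ε(v_{i+1})} τ_{i,i+1}(⊗v)` for homogeneous `v_k`) has
dimension `Σ_{k=0}^{min(d₀,n)} C(d₀,k) · C(d₁+(n-k)-1, n-k)`. -/
theorem dim_alternating_superpower
    (F : Type) [Field F] (hchar : (2 : F) ≠ 0) (n : ℕ) (hn : 2 ≤ n)
    (V : Type) [AddCommGroup V] [Module F V] [FiniteDimensional F V]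
    (gV : ZMod 2 → Submodule F V) (hgV : DirectSum.IsInternal gV) :
    let R : Submodule F (⨂[F] (_ : Fin n), V) := Submodule.span F
      {t | ∃ (p : Fin n → ZMod 2) (v : Fin n → V) (i : ℕ) (hi : i + 1 < n),
        (∀ k, v k ∈ gV (p k)) ∧
        t = (⨂ₜ[F] k, v k) +
          ((-1 : F) ^ ((p ⟨i, by omega⟩ * p ⟨i + 1, hi⟩).val)) •
            ⨂ₜ[F] k, v (Equiv.swap (⟨i, by omega⟩ : Fin n) ⟨i + 1, hi⟩ k)}
    let d₀ := Module.finrank F (gV 0)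
    let d₁ := Module.finrank F (gV 1)
    Module.finrank F ((⨂[F] (_ : Fin n), V) ⧸ R)
      = ∑ k ∈ Finset.range (min d₀ n + 1),
          Nat.choose d₀ k * Nat.choose (d₁ + (n - k) - 1) (n - k) := by
  intro R d₀ d₁
  classical
  obtain ⟨N, rfl⟩ : ∃ N, n = N + 1 := ⟨n - 1, by omega⟩
  obtain ⟨b, hb, hrepr⟩ := SuperPow.exists_basis F V gV hgV
  let e := Basis.piTensorProduct (R := F) (fun _ : Fin (N + 1) => b)
  have he : ∀ f, e f = ⨂ₜ[F] k, b (f k) := fun f => Basis.piTensorProduct_apply _ f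
  rw [← SuperPow.card_Idx, ← Nat.card_eq_fintype_card]
  refine SuperPow.core F hchar N _ e R ?_ ?_
  · intro f i
    apply Submodule.subset_span
    refine ⟨fun k => SuperPow.par (f k), fun k => b (f k), i, by omega, fun k => hb _, ?_⟩
    rw [he, he]
    rfl
  · intro Φ hΦ
    rw [Submodule.span_le]
    rintro _ ⟨p, v, i, hi, hv, rfl⟩
    have hf : ∀ w : Fin (N + 1) → V, Φ (⨂ₜ[F] k, w k) =
        ∑ f : Fin (N + 1) → _, (∏ k, b.repr (w k) (f k)) • Φ (e f) := by
      intro w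
      conv_lhs => rw [← e.sum_repr (⨂ₜ[F] k, w k)]
      rw [map_sum]
      refine Finset.sum_congr rfl fun f _ => ?_
      rw [map_smul, Basis.piTensorProduct_repr_tprod_apply]
    let j : Fin N := ⟨i, by omega⟩
    let τ := Equiv.swap j.castSucc j.succ
    change Φ ((⨂ₜ[F] k, v k) + ((-1 : F) ^ ((p j.castSucc * p j.succ).val)) •
      ⨂ₜ[F] k, v (τ k)) = 0
    rw [map_add, map_smul, hf v, hf (fun k => v (τ k))]
    have hre : ∑ f : Fin (N + 1) → _, (∏ k, b.repr (v (τ k)) (f k)) • Φ (e f) =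
        ∑ f : Fin (N + 1) → _, (∏ k, b.repr (v k) (f k)) • Φ (e (f ∘ τ)) := by
      refine Fintype.sum_equiv (Equiv.arrowCongr τ (Equiv.refl _)) _ _ fun f => ?_
      have h1 : ∀ g : Fin (N + 1) → _,
          (Equiv.arrowCongr τ (Equiv.refl (Fin d₀ ⊕ Fin d₁))) g = g ∘ τ := by
        intro g
        funext k
        simp [Equiv.arrowCongr, τ]
      rw [h1]
      have h2 : (f ∘ τ) ∘ τ = f := by
        funext k
        simp [τ]
      rw [h2]
      congr 1
      refine Fintype.prod_equiv τ _ _ fun k => ?_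
      simp [τ]
    rw [hre, Finset.smul_sum, ← Finset.sum_add_distrib]
    refine Finset.sum_eq_zero fun f _ => ?_
    by_cases h0 : ∏ k, b.repr (v k) (f k) = 0
    · rw [h0]; simp
    · have hp : ∀ k, SuperPow.par (f k) = p k := fun k =>
        hrepr (p k) (v k) (hv k) (f k) fun h => h0 (Finset.prod_eq_zero (Finset.mem_univ k) h)
      rw [hΦ f j, hp, hp, smul_smul, smul_smul, ← add_smul]
      have hsq : ∀ k : ℕ, ((-1 : F) ^ k) * (-1) ^ k = 1 := fun k => by
        rw [← mul_pow]; simp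
      have : ∀ (c s : F), s * s = 1 → c + s * (c * -s) = 0 := by
        intro c s hs
        linear_combination (-c) * hs
      rw [mul_assoc, this _ _ (hsq _), zero_smul]
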